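/- arXiv:1309.3704 — 5 statements merged into one kernel-verified Lean document; each statement's English description precedes it below -/
import Mathlib

section
/- Let (Ω, μ) be a probability space and X : Ω → ℝ a measurable random variable with 0 < X ≤ M almost surely for some constant M > 0, and let a > 0 be a constant. Then there exists a unique λ* ∈ ℝ satisfying the threshold equation E[(X − λ*)⁺] = λ*·a, and moreover this λ* satisfies 0 < λ* ≤ M. (Existence and uniqueness of the optimal stopping threshold, the analytic content of Theorem 1.) -/
open MeasureTheory

/-- Analytic content of Theorem 1: for a measurable random variable `X` on a
probability space with `0 < X ≤ M` almost surely (`M > 0`) and a constant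
`a > 0`, there exists a unique `λ*` solving the threshold equation
`E[(X − λ*)⁺] = λ*·a`, and this `λ*` satisfies `0 < λ* ≤ M`. -/
theorem threshold_exists_unique {Ω : Type*} [MeasurableSpace Ω]
    (μ : Measure Ω) [IsProbabilityMeasure μ]
    (X : Ω → ℝ) (hX : Measurable X) (M : ℝ) (hM : 0 < M)
    (hbound : ∀ᵐ ω ∂μ, 0 < X ω ∧ X ω ≤ M)
    (a : ℝ) (ha : 0 < a) :
    ∃ l : ℝ, (∫ ω, max (X ω - l) 0 ∂μ) = l * a ∧ 0 < l ∧ l ≤ M ∧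
      ∀ l' : ℝ, (∫ ω, max (X ω - l') 0 ∂μ) = l' * a → l' = l := by
  have hXi : Integrable X μ := by
    refine Integrable.of_bound hX.aestronglyMeasurable M ?_
    filter_upwards [hbound] with ω h
    rw [Real.norm_eq_abs, abs_of_pos h.1]
    exact h.2
  have hint : ∀ l : ℝ, Integrable (fun ω => max (X ω - l) 0) μ := fun l =>
    (hXi.sub (integrable_const l)).pos_part
  have hanti : ∀ l l' : ℝ, l ≤ l' →
      (∫ ω, max (X ω - l') 0 ∂μ) ≤ ∫ ω, max (X ω - l) 0 ∂μ := by
    intro l l' h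
    refine integral_mono (hint l') (hint l) ?_
    intro ω
    exact max_le_max (by linarith) le_rfl
  have hlip : ∀ l l' : ℝ, l ≤ l' →
      (∫ ω, max (X ω - l) 0 ∂μ) ≤ (∫ ω, max (X ω - l') 0 ∂μ) + (l' - l) := by
    intro l l' h
    have h1 : (∫ ω, (max (X ω - l') 0 + (l' - l)) ∂μ)
        = (∫ ω, max (X ω - l') 0 ∂μ) + (l' - l) := by
      rw [integral_add (hint l') (integrable_const _)]
      simp
    rw [← h1]
    refine integral_mono (hint l) ((hint l').add (integrable_const _)) ?_
    intro ω
    have h2 := le_max_left (X ω - l') 0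
    have h3 := le_max_right (X ω - l') 0
    exact max_le (by dsimp; linarith) (by dsimp; linarith)
  have hcont : Continuous (fun l : ℝ => ∫ ω, max (X ω - l) 0 ∂μ) := by
    refine (LipschitzWith.of_le_add (fun l l' => ?_)).continuous
    rcases le_total l l' with h | h
    · have := hlip l l' h
      rw [Real.dist_eq, abs_sub_comm, abs_of_nonneg (by linarith)]
      exact this
    · have := hanti l' l h
      have := dist_nonneg (x := l) (y := l')
      linarith
  have hzero : (∫ ω, max (X ω - M) 0 ∂μ) = 0 := by
    refine integral_eq_zero_of_ae ?_
    filter_upwards [hbound] with ω h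
    exact max_eq_right (by linarith [h.2])
  have hpos : 0 < ∫ ω, max (X ω - 0) 0 ∂μ := by
    have h0 : 0 ≤ ∫ ω, max (X ω - 0) 0 ∂μ := integral_nonneg fun ω => le_max_right _ _
    refine lt_of_le_of_ne h0 fun h => ?_
    have h1 := (integral_eq_zero_iff_of_nonneg (fun ω => le_max_right _ _) (hint 0)).1 h.symm
    have h2 : ∀ᵐ ω ∂μ, False := by
      filter_upwards [hbound, h1] with ω h3 h4
      have h5 := le_max_left (X ω - 0) 0
      simp only [Pi.zero_apply] at h4
      linarith [h3.1]
    obtain ⟨_, hf⟩ := h2.exists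
    exact hf
  obtain ⟨l, hl, hl0⟩ := intermediate_value_Icc' hM.le
    (f := fun l : ℝ => (∫ ω, max (X ω - l) 0 ∂μ) - l * a)
    (hcont.sub (continuous_id.mul continuous_const)).continuousOn
    (show (0 : ℝ) ∈ _ from ⟨by rw [hzero]; nlinarith, by linarith⟩)
  have hl1 : (∫ ω, max (X ω - l) 0 ∂μ) = l * a := by
    dsimp only at hl0
    linarith
  refine ⟨l, hl1, ?_, hl.2, ?_⟩
  · refine lt_of_le_of_ne hl.1 fun h => ?_
    rw [← h] at hl1
    linarith
  · intro l' h'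
    rcases lt_trichotomy l' l with h | h | h
    · have := hanti l' l h.le
      nlinarith
    · exact h
    · have := hanti l l' h.le
      nlinarith
end

section
/- Let (Ω, μ) be a probability space, X : Ω → ℝ an integrable random variable, and 0 < a ≤ a'. Suppose λ ≥ 0 satisfies E[(X − λ)⁺] = λ·a and λ' ≥ 0 satisfies E[(X − λ')⁺] = λ'·a'. Then λ' ≤ λ; that is, the optimal stopping threshold is non-increasing in the normalized contention delay a = t^c/T. (Base case of the induction proving Lemma 2, monotonicity of the value function in the load vector G.) -/
open MeasureTheory

/-- Base case of the induction proving Lemma 2: the optimal stopping threshold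
is non-increasing in the normalized contention delay `a = t^c/T`. If
`λ ≥ 0` solves `E[(X − λ)⁺] = λ·a` and `λ' ≥ 0` solves
`E[(X − λ')⁺] = λ'·a'` with `0 < a ≤ a'`, then `λ' ≤ λ`. -/
theorem threshold_antitone_in_contention {Ω : Type*} [MeasurableSpace Ω]
    (μ : Measure Ω) [IsProbabilityMeasure μ]
    (X : Ω → ℝ) (hX : Integrable X μ)
    (a a' : ℝ) (ha : 0 < a) (haa' : a ≤ a')
    (l l' : ℝ) (hl : 0 ≤ l) (hl' : 0 ≤ l')
    (heq : (∫ ω, max (X ω - l) 0 ∂μ) = l * a)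
    (heq' : (∫ ω, max (X ω - l') 0 ∂μ) = l' * a') :
    l' ≤ l := by
  by_contra! h
  have hint : ∀ c : ℝ, Integrable (fun ω => max (X ω - c) 0) μ := fun c =>
    (hX.sub (integrable_const c)).pos_part
  have hmono : (∫ ω, max (X ω - l') 0 ∂μ) ≤ ∫ ω, max (X ω - l) 0 ∂μ :=
    integral_mono (hint l') (hint l) fun ω => max_le_max (by linarith) le_rfl
  rw [heq, heq'] at hmono
  have h1 : l * a < l' * a := mul_lt_mul_of_pos_right h ha
  have h2 : l' * a ≤ l' * a' := mul_le_mul_of_nonneg_left haa' hl'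
  linarith
end

section
/- Let (Ω, μ) be a probability space, X : Ω → ℝ an integrable random variable, t > 0 a fixed contention delay, and 0 < T ≤ T' two transmission times. Suppose λ ≥ 0 satisfies E[(X − λ)⁺] = λ·t/T and λ' ≥ 0 satisfies E[(X − λ')⁺] = λ'·t/T'. Then λ ≤ λ'; that is, the optimal stopping threshold at the last stage is non-decreasing in the data transmission time T. (Base case of the induction proving Lemma 6, the impact of T.) -/
open MeasureTheory

/-- Base case of the induction proving Lemma 6 (impact of `T`): the optimal
stopping threshold at the last stage is non-decreasing in the transmission
time `T`. If `λ ≥ 0` solves `E[(X − λ)⁺] = λ·t/T` and `λ' ≥ 0` solves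
`E[(X − λ')⁺] = λ'·t/T'` with `0 < T ≤ T'` and `t > 0`, then `λ ≤ λ'`. -/
theorem threshold_monotone_in_T {Ω : Type*} [MeasurableSpace Ω]
    (μ : Measure Ω) [IsProbabilityMeasure μ]
    (X : Ω → ℝ) (hX : Integrable X μ)
    (t : ℝ) (ht : 0 < t) (T T' : ℝ) (hT : 0 < T) (hTT' : T ≤ T')
    (l l' : ℝ) (hl : 0 ≤ l) (hl' : 0 ≤ l')
    (heq : (∫ ω, max (X ω - l) 0 ∂μ) = l * t / T)
    (heq' : (∫ ω, max (X ω - l') 0 ∂μ) = l' * t / T') :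
    l ≤ l' := by
  by_contra! h
  have h1 : (∫ ω, max (X ω - l) 0 ∂μ) ≤ ∫ ω, max (X ω - l') 0 ∂μ := by
    apply integral_mono
    · exact (hX.sub (integrable_const l)).pos_part
    · exact (hX.sub (integrable_const l')).pos_part
    · intro ω
      exact max_le_max (by linarith) le_rfl
  have h2 : l' * t / T' ≤ l' * t / T :=
    div_le_div_of_nonneg_left (mul_nonneg hl' ht.le) hT hTT'
  have h3 : l' * t / T < l * t / T :=
    div_lt_div_of_pos_right (mul_lt_mul_of_pos_right h ht) hT
  linarith
end

section
/- Let (Ω, μ) be a probability space, X, Y : Ω → ℝ integrable random variables with X ≤ Y almost surely, and a > 0 a constant. Suppose λ_X ≥ 0 satisfies E[(X − λ_X)⁺] = λ_X·a and λ_Y ≥ 0 satisfies E[(Y − λ_Y)⁺] = λ_Y·a. Then λ_X ≤ λ_Y; that is, the optimal stopping threshold is monotone in the reward variable. (Comparison step used in the induction proving Lemma 2.) -/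
open MeasureTheory

/-- Comparison step used in the induction proving Lemma 2: the optimal
stopping threshold is monotone in the reward variable. If `X ≤ Y` a.s.,
`λ_X ≥ 0` solves `E[(X − λ_X)⁺] = λ_X·a` and `λ_Y ≥ 0` solves
`E[(Y − λ_Y)⁺] = λ_Y·a` with `a > 0`, then `λ_X ≤ λ_Y`. -/
theorem threshold_monotone_in_reward {Ω : Type*} [MeasurableSpace Ω]
    (μ : Measure Ω) [IsProbabilityMeasure μ]
    (X Y : Ω → ℝ) (hX : Integrable X μ) (hY : Integrable Y μ)
    (hXY : ∀ᵐ ω ∂μ, X ω ≤ Y ω)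
    (a : ℝ) (ha : 0 < a)
    (lX lY : ℝ) (hlX : 0 ≤ lX) (hlY : 0 ≤ lY)
    (heqX : (∫ ω, max (X ω - lX) 0 ∂μ) = lX * a)
    (heqY : (∫ ω, max (Y ω - lY) 0 ∂μ) = lY * a) :
    lX ≤ lY := by
  by_contra! h
  have hle : (∫ ω, max (X ω - lX) 0 ∂μ) ≤ ∫ ω, max (Y ω - lY) 0 ∂μ := by
    apply integral_mono_ae
    · exact (hX.sub (integrable_const lX)).pos_part
    · exact (hY.sub (integrable_const lY)).pos_part
    · filter_upwards [hXY] with ω hω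
      exact max_le_max (by linarith) le_rfl
  rw [heqX, heqY] at hle
  exact absurd (mul_lt_mul_of_pos_right h ha) (not_lt.mpr hle)
end

section
/- Let S = {1,…,n} be a finite state space, U a finite nonempty action set, r : U × S → ℝ, for each u ∈ U let P^u be row-stochastic, and let η ∈ (0,1). Then there exists a unique function V : S → ℝ satisfying the dynamic programming equations V(x) = max_{u∈U} [ r(u,x) + η ∑_{y∈S} P^u(y|x) V(y) ] for all x ∈ S. (Theorem 2: uniqueness of the solution of the Markovian value equations.) -/
/-- The Bellman operator `(Tv)(x) = max_{u∈U} [ r(u,x) + η ∑_y P^u(y|x) v(y) ]`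
on a finite state space `S = Fin n` with finite nonempty action set `U`. -/
noncomputable def bellmanOp {n : ℕ} {U : Type*} [Fintype U] [Nonempty U]
    (r : U → Fin n → ℝ) (P : U → Fin n → Fin n → ℝ) (η : ℝ)
    (v : Fin n → ℝ) : Fin n → ℝ :=
  fun x => ⨆ u : U, (r u x + η * ∑ y : Fin n, P u x y * v y)

theorem bellmanOp_le_aux {n : ℕ} {U : Type*} [Fintype U] [Nonempty U]
    (r : U → Fin n → ℝ) (P : U → Fin n → Fin n → ℝ)
    (hPnonneg : ∀ u x y, 0 ≤ P u x y)
    (hPsum : ∀ u x, ∑ y : Fin n, P u x y = 1)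
    (η : ℝ) (hη0 : 0 < η) (v w : Fin n → ℝ) (x : Fin n) :
    bellmanOp r P η v x ≤ bellmanOp r P η w x + η * dist v w := by
  unfold bellmanOp
  refine ciSup_le fun u => ?_
  have h1 : r u x + η * ∑ y : Fin n, P u x y * w y ≤
      ⨆ u : U, (r u x + η * ∑ y : Fin n, P u x y * w y) :=
    le_ciSup (f := fun u : U => r u x + η * ∑ y : Fin n, P u x y * w y)
      (Set.finite_range _).bddAbove u
  have h2 : ∑ y : Fin n, P u x y * v y ≤ ∑ y : Fin n, P u x y * w y + dist v w := by
    calc ∑ y : Fin n, P u x y * v y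
        ≤ ∑ y : Fin n, (P u x y * w y + P u x y * dist v w) := by
          refine Finset.sum_le_sum fun y _ => ?_
          rw [← mul_add]
          refine mul_le_mul_of_nonneg_left ?_ (hPnonneg u x y)
          have h3 := dist_le_pi_dist v w y
          rw [Real.dist_eq] at h3
          linarith [le_abs_self (v y - w y)]
      _ = ∑ y : Fin n, P u x y * w y + dist v w := by
          rw [Finset.sum_add_distrib, ← Finset.sum_mul, hPsum, one_mul]
  have h4 := mul_le_mul_of_nonneg_left h2 hη0.le
  linarith

/-- Theorem 2: with row-stochastic transition matrices `P^u` and discount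
`η ∈ (0,1)`, there is a unique `V : Fin n → ℝ` satisfying the dynamic
programming equations `V(x) = max_{u∈U} [ r(u,x) + η ∑_y P^u(y|x) V(y) ]`. -/
theorem bellman_unique_fixed_point {n : ℕ} (hn : 0 < n)
    {U : Type*} [Fintype U] [Nonempty U]
    (r : U → Fin n → ℝ) (P : U → Fin n → Fin n → ℝ)
    (hPnonneg : ∀ u x y, 0 ≤ P u x y)
    (hPsum : ∀ u x, ∑ y : Fin n, P u x y = 1)
    (η : ℝ) (hη0 : 0 < η) (hη1 : η < 1) :
    ∃! V : Fin n → ℝ, ∀ x : Fin n, V x = bellmanOp r P η V x := by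
  have hc : ContractingWith ⟨η, hη0.le⟩ (bellmanOp r P η) := by
    refine ⟨by exact_mod_cast hη1, LipschitzWith.of_dist_le_mul fun v w => ?_⟩
    change _ ≤ η * dist v w
    refine (dist_pi_le_iff (mul_nonneg hη0.le dist_nonneg)).2 fun x => ?_
    have h1 := bellmanOp_le_aux r P hPnonneg hPsum η hη0 v w x
    have h2 := bellmanOp_le_aux r P hPnonneg hPsum η hη0 w v x
    rw [dist_comm w v] at h2
    rw [Real.dist_eq, abs_le]
    constructor <;> linarith
  refine ⟨ContractingWith.fixedPoint _ hc, fun x => ?_, fun W hW => ?_⟩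
  · exact (congrFun hc.fixedPoint_isFixedPt x).symm
  · exact hc.fixedPoint_unique (funext fun x => (hW x).symm)
end
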